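/- arXiv:2208.13091 — 3 statements merged into one kernel-verified Lean document; each statement's English description precedes it below -/
import Mathlib

section
/- For every positive integer k, the sum over j from 1 to k of S(k,j) times I(j) equals the sum over t from 1 to k of S(k,t) times 2^(k-t); that is, ∑_{j=1}^{k} S(k,j)·I(j) = ∑_{t=1}^{k} S(k,t)·2^{k-t}. -/
/-- `stirling k j` is the Stirling number of the second kind: the number of set
partitions of `{1, ..., k}` into exactly `j` nonempty blocks. -/
noncomputable def stirling (k j : ℕ) : ℕ :=
  Nat.card {P : Finpartition (Finset.Icc 1 k) // P.parts.card = j}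

/-- `numInvolutions j` is the number of involutions in the symmetric group on `j` letters,
i.e. permutations `σ` with `σ ∘ σ = id`. -/
noncomputable def numInvolutions (j : ℕ) : ℕ :=
  Nat.card {σ : Equiv.Perm (Fin j) // σ * σ = 1}

namespace StirlingInvolution

/-- The operator `f ↦ (j ↦ f (j + 1) + j * f j)`, which records how the number of blocks can change
when a point is added to a set partition. -/
def stirlingOp (f : ℕ → ℕ) (j : ℕ) : ℕ := f (j + 1) + j * f j

/-- The operator `f ↦ (j ↦ f j + j * f (j - 1))`; on exponential generating functions it is
multiplication by `1 + y`. -/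
def mulOp (f : ℕ → ℕ) (j : ℕ) : ℕ := f j + j * f (j - 1)

lemma stirlingOp_mulOp (f : ℕ → ℕ) (j : ℕ) :
    stirlingOp (mulOp f) j = mulOp (stirlingOp f) j + mulOp f j := by
  rcases j with _ | j
  · simp [stirlingOp, mulOp]
  · simp [stirlingOp, mulOp]
    ring

lemma mulOp_add (f g : ℕ → ℕ) (j : ℕ) :
    mulOp (fun i => f i + g i) j = mulOp f j + mulOp g j := by
  simp only [mulOp]; ring

lemma mulOp_const_mul (c : ℕ) (f : ℕ → ℕ) (j : ℕ) :
    mulOp (fun i => c * f i) j = c * mulOp f j := by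
  simp only [mulOp]; ring

lemma stirlingOp_iterate_mulOp (f : ℕ → ℕ) (m j : ℕ) :
    stirlingOp (mulOp^[m] f) j = mulOp^[m] (stirlingOp f) j + m * mulOp^[m] f j := by
  induction m generalizing j with
  | zero => simp
  | succ m ih =>
    rw [Function.iterate_succ_apply', Function.iterate_succ_apply', stirlingOp_mulOp, funext ih,
      mulOp_add, mulOp_const_mul]
    ring

lemma iterate_mulOp_zero (f : ℕ → ℕ) (m : ℕ) : mulOp^[m] f 0 = f 0 := by
  induction m with
  | zero => rfl
  | succ m ih => rw [Function.iterate_succ_apply', mulOp, ih]; simp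

lemma stirlingOp_eq_mulOp_mulOp {f : ℕ → ℕ} (hf : ∀ j, f (j + 1) = f j + j * f (j - 1)) :
    stirlingOp f = mulOp (mulOp f) := by
  funext j
  rcases j with _ | j <;> simp [stirlingOp, mulOp, hf]

/-! ### Involutions -/

section Involutions

variable {α β : Type*}

lemma card_involutive_congr (e : α ≃ β) :
    Nat.card {σ : Equiv.Perm α // σ * σ = 1} = Nat.card {σ : Equiv.Perm β // σ * σ = 1} := by
  refine Nat.card_congr (e.permCongrHom.toEquiv.subtypeEquiv fun σ => ?_)
  change _ ↔ e.permCongrHom σ * e.permCongrHom σ = 1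
  rw [← map_mul, map_eq_one_iff _ e.permCongrHom.injective]

lemma numInvolutions_card [Finite α] :
    Nat.card {σ : Equiv.Perm α // σ * σ = 1} = numInvolutions (Nat.card α) :=
  card_involutive_congr (Finite.equivFin α)

lemma card_involutive_fixing [Finite α] (i : α) :
    Nat.card {σ : Equiv.Perm α // σ i = i ∧ σ * σ = 1} = numInvolutions (Nat.card α - 1) := by
  classical
  have : Nat.card {x : α // x ≠ i} = Nat.card α - 1 := by
    have := Fintype.ofFinite α
    simp [Nat.card_eq_fintype_card]
  rw [← this, ← numInvolutions_card]
  refine (Nat.card_congr ?_).symm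
  refine ((Equiv.Perm.subtypeEquivSubtypePerm (fun x : α => x ≠ i)).subtypeEquiv
    (q := fun f => f.1 * f.1 = 1) fun σ => ?_).trans ?_
  · change _ ↔ Equiv.Perm.ofSubtype σ * Equiv.Perm.ofSubtype σ = 1
    rw [← map_mul, map_eq_one_iff _ Equiv.Perm.ofSubtype_injective]
  · refine (Equiv.subtypeSubtypeEquivSubtypeInter _ (fun f : Equiv.Perm α => f * f = 1)).trans ?_
    exact Equiv.subtypeEquivRight fun f => by simp

lemma decomposeOption_symm_none_mul_self [DecidableEq α] (τ : Equiv.Perm α) :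
    Equiv.Perm.decomposeOption.symm (none, τ) * Equiv.Perm.decomposeOption.symm (none, τ) = 1 ↔
      τ * τ = 1 := by
  simp only [Equiv.ext_iff, Option.forall]
  simp

lemma decomposeOption_symm_some_mul_self [DecidableEq α] (i : α) (τ : Equiv.Perm α) :
    Equiv.Perm.decomposeOption.symm (some i, τ) * Equiv.Perm.decomposeOption.symm (some i, τ) = 1 ↔
      τ i = i ∧ τ * τ = 1 := by
  have h1 : ∀ x : Option α, Equiv.Perm.decomposeOption.symm (some i, τ) x =
      Equiv.swap none (some i) (x.map τ) := fun x => by simp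
  simp only [Equiv.ext_iff, Option.forall, Equiv.Perm.mul_apply, h1, Equiv.Perm.one_apply]
  by_cases hi : τ i = i
  · simp only [hi, Option.map_none, Equiv.swap_apply_left, Option.map_some, true_and,
      Equiv.swap_apply_right]
    refine forall_congr' fun a => ?_
    by_cases ha : τ a = i
    · obtain rfl : a = i := τ.injective (ha.trans hi.symm)
      simp [hi]
    · have : τ (τ a) ≠ i := fun h => ha (τ.injective (h.trans hi.symm))
      simp [Equiv.swap_apply_def, ha, this]
  · simp [hi, Equiv.swap_apply_def]

lemma card_involutive_option [Fintype α] :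
    Nat.card {σ : Equiv.Perm (Option α) // σ * σ = 1} =
      numInvolutions (Nat.card α) + Nat.card α * numInvolutions (Nat.card α - 1) := by
  classical
  have e : {σ : Equiv.Perm (Option α) // σ * σ = 1} ≃
      Σ o : Option α, {τ : Equiv.Perm α // Equiv.Perm.decomposeOption.symm (o, τ) *
        Equiv.Perm.decomposeOption.symm (o, τ) = 1} :=
    (Equiv.Perm.decomposeOption.subtypeEquiv (q := fun p => Equiv.Perm.decomposeOption.symm p *
        Equiv.Perm.decomposeOption.symm p = 1) (fun σ => by simp)).trans
      (Equiv.subtypeProdEquivSigmaSubtype fun o τ => Equiv.Perm.decomposeOption.symm (o, τ) *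
        Equiv.Perm.decomposeOption.symm (o, τ) = 1)
  rw [Nat.card_congr e, Nat.card_sigma, Fintype.sum_option]
  simp_rw [decomposeOption_symm_none_mul_self, decomposeOption_symm_some_mul_self,
    card_involutive_fixing, numInvolutions_card]
  simp

lemma numInvolutions_succ (j : ℕ) :
    numInvolutions (j + 1) = numInvolutions j + j * numInvolutions (j - 1) := by
  have := card_involutive_option (α := Fin j)
  rw [numInvolutions_card] at this
  simpa using this

lemma numInvolutions_zero : numInvolutions 0 = 1 := by
  simp [numInvolutions, Subsingleton.elim _ (1 : Equiv.Perm (Fin 0))]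

end Involutions

/-! ### Set partitions -/

section Partitions

variable {α : Type*} [DecidableEq α] {s : Finset α} {a : α}

/-- Adjoin to a partition of `s` the new point `a`, either as a singleton block (`none`) or inside
the existing block `B` (`some B`). -/
def insertPoint (ha : a ∉ s) (p : Σ P : Finpartition s, Option P.parts) :
    Finpartition (insert a s) :=
  match p with
  | ⟨P, none⟩ => Finpartition.ofExistsUnique (insert {a} P.parts)
      (by
        intro p hp
        rcases Finset.mem_insert.1 hp with rfl | hp
        · simp
        · exact (P.le hp).trans (Finset.subset_insert a s))
      (by
        intro x hx
        have hP : ∀ t ∈ P.parts, a ∉ t := fun t ht h => ha (P.le ht h)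
        rcases Finset.mem_insert.1 hx with rfl | hx
        · exact ⟨{x}, by simp, by grind⟩
        · obtain ⟨t, ht, hu⟩ := P.existsUnique_mem hx
          exact ⟨t, by grind, by grind⟩)
      (by simp [(Finset.singleton_ne_empty a).symm])
  | ⟨P, some B⟩ => Finpartition.ofExistsUnique (insert (insert a B.1) (P.parts.erase B.1))
      (by
        intro p hp
        rcases Finset.mem_insert.1 hp with rfl | hp
        · exact Finset.insert_subset_insert a (P.le B.2)
        · exact (P.le (Finset.mem_of_mem_erase hp)).trans (Finset.subset_insert a s))
      (by
        intro x hx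
        have hP : ∀ t ∈ P.parts, a ∉ t := fun t ht h => ha (P.le ht h)
        have hB := B.2
        rcases Finset.mem_insert.1 hx with rfl | hx
        · exact ⟨insert x B.1, by simp, by grind⟩
        · obtain ⟨t, ht, hu⟩ := P.existsUnique_mem hx
          by_cases h : x ∈ B.1
          · exact ⟨insert a B.1, by grind, by grind⟩
          · exact ⟨t, by grind, by grind⟩)
      (by simp [(Finset.insert_ne_empty a _).symm])

lemma insertPoint_none_parts (ha : a ∉ s) (P : Finpartition s) :
    (insertPoint ha ⟨P, none⟩).parts = insert {a} P.parts := rfl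

lemma insertPoint_some_parts (ha : a ∉ s) (P : Finpartition s) (B : P.parts) :
    (insertPoint ha ⟨P, some B⟩).parts = insert (insert a B.1) (P.parts.erase B.1) := rfl

lemma notMem_of_mem_parts (ha : a ∉ s) {P : Finpartition s} {t : Finset α} (ht : t ∈ P.parts) :
    a ∉ t := fun h => ha (P.le ht h)

lemma card_insertPoint_none (ha : a ∉ s) (P : Finpartition s) :
    (insertPoint ha ⟨P, none⟩).parts.card = P.parts.card + 1 := by
  rw [insertPoint_none_parts, Finset.card_insert_of_notMem]
  exact fun h => notMem_of_mem_parts ha h (Finset.mem_singleton_self a)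

lemma card_insertPoint_some (ha : a ∉ s) (P : Finpartition s) (B : P.parts) :
    (insertPoint ha ⟨P, some B⟩).parts.card = P.parts.card := by
  rw [insertPoint_some_parts, Finset.card_insert_of_notMem, Finset.card_erase_add_one B.2]
  exact fun h => notMem_of_mem_parts ha (Finset.mem_of_mem_erase h) (Finset.mem_insert_self a _)

lemma mem_parts_iff_insertPoint (ha : a ∉ s) (p : Σ P : Finpartition s, Option P.parts)
    (t : Finset α) : t ∈ p.1.parts ↔
      t.Nonempty ∧ a ∉ t ∧
        (t ∈ (insertPoint ha p).parts ∨ insert a t ∈ (insertPoint ha p).parts) := by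
  have hP : ∀ t ∈ p.1.parts, a ∉ t := fun t ht => notMem_of_mem_parts ha ht
  have hne : ∀ t ∈ p.1.parts, t.Nonempty := fun t ht => p.1.nonempty_of_mem_parts ht
  rcases p with ⟨P, _ | B⟩
  · rw [insertPoint_none_parts]
    have h1 : a ∉ t → t.Nonempty → insert a t ≠ {a} := by
      rintro h ⟨x, hx⟩ he
      have : x ∈ ({a} : Finset α) := he ▸ Finset.mem_insert_of_mem hx
      grind
    grind
  · rw [insertPoint_some_parts]
    have hB := B.2
    have h1 : a ∉ t → insert a t = insert a B.1 → t = B.1 := by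
      intro h he
      rw [← Finset.erase_insert h, he, Finset.erase_insert (hP _ hB)]
    grind

lemma insertPoint_injective (ha : a ∉ s) : Function.Injective (insertPoint ha) := by
  rintro ⟨P, o⟩ ⟨P', o'⟩ h
  obtain rfl : P = P' := by
    ext t
    rw [mem_parts_iff_insertPoint ha ⟨P, o⟩, mem_parts_iff_insertPoint ha ⟨P', o'⟩, h]
  have hP : ∀ t ∈ P.parts, a ∉ t := fun t ht => notMem_of_mem_parts ha ht
  have hc := congrArg (fun Q => Q.parts.card) h
  rcases o with _ | B <;> rcases o' with _ | B'
  · rfl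
  · simp [card_insertPoint_none, card_insertPoint_some] at hc
  · simp [card_insertPoint_none, card_insertPoint_some] at hc
  · have hm : insert a B.1 ∈ (insertPoint ha ⟨P, some B'⟩).parts := by
      rw [← h, insertPoint_some_parts]
      exact Finset.mem_insert_self _ _
    rw [insertPoint_some_parts, Finset.mem_insert] at hm
    rcases hm with hm | hm
    · have : B = B' := Subtype.ext (by
        rw [← Finset.erase_insert (hP _ B.2), hm, Finset.erase_insert (hP _ B'.2)])
      rw [this]
    · exact absurd (Finset.mem_insert_self a _) (hP _ (Finset.mem_of_mem_erase hm))

lemma insertPoint_surjective (ha : a ∉ s) : Function.Surjective (insertPoint ha) := by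
  intro Q
  have hpa : Q.part a ∈ Q.parts := Q.part_mem.2 (Finset.mem_insert_self a s)
  have haa : a ∈ Q.part a := Q.mem_part (Finset.mem_insert_self a s)
  have huniq : ∀ t ∈ Q.parts, a ∈ t → t = Q.part a := fun t ht h =>
    Q.eq_of_mem_parts ht hpa h haa
  have hle : ∀ t ∈ Q.parts, a ∉ t → t ⊆ s := fun t ht h x hx => by
    have := Q.le ht hx
    grind
  have hQ : ∅ ∉ Q.parts := Q.empty_notMem_parts
  by_cases hB : Q.part a = {a}
  · refine ⟨⟨Finpartition.ofExistsUnique (Q.parts.erase {a}) ?_ ?_ ?_, none⟩, ?_⟩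
    · intro t ht
      exact hle t (Finset.mem_of_mem_erase ht) (by grind)
    · intro x hx
      obtain ⟨t, ht, hu⟩ := Q.existsUnique_mem (Finset.mem_insert_of_mem (b := a) hx)
      exact ⟨t, by grind, by grind⟩
    · grind
    · ext1
      rw [insertPoint_none_parts, Finpartition.ofExistsUnique_parts,
        Finset.insert_erase (hB ▸ hpa)]
  · have hne : (Q.part a).erase a ≠ ∅ := by
      intro h
      rw [Finset.erase_eq_empty_iff] at h
      grind
    have hnot : (Q.part a).erase a ∉ Q.parts := by
      intro h
      obtain ⟨x, hx⟩ := Finset.nonempty_iff_ne_empty.2 hne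
      have := Q.eq_of_mem_parts h hpa hx (Finset.mem_of_mem_erase hx)
      grind
    refine ⟨⟨Finpartition.ofExistsUnique
      (insert ((Q.part a).erase a) (Q.parts.erase (Q.part a))) ?_ ?_ ?_,
      some ⟨(Q.part a).erase a, Finset.mem_insert_self _ _⟩⟩, ?_⟩
    · intro t ht
      rcases Finset.mem_insert.1 ht with rfl | ht
      · intro x hx
        have := Q.le hpa (Finset.mem_of_mem_erase hx)
        grind
      · exact hle t (Finset.mem_of_mem_erase ht) (by grind)
    · intro x hx
      obtain ⟨t, ht, hu⟩ := Q.existsUnique_mem (Finset.mem_insert_of_mem (b := a) hx)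
      by_cases h : x ∈ Q.part a
      · exact ⟨(Q.part a).erase a, by grind, by grind⟩
      · exact ⟨t, by grind, by grind⟩
    · grind
    · ext1
      rw [insertPoint_some_parts]
      change insert (insert a ((Q.part a).erase a)) ((insert ((Q.part a).erase a)
        (Q.parts.erase (Q.part a))).erase ((Q.part a).erase a)) = Q.parts
      rw [Finset.insert_erase haa,
        Finset.erase_insert (by grind), Finset.insert_erase hpa]

lemma sum_finpartition_insert (ha : a ∉ s) (f : ℕ → ℕ) :
    ∑ Q : Finpartition (insert a s), f Q.parts.card =
      ∑ P : Finpartition s, stirlingOp f P.parts.card := by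
  rw [← Function.Bijective.sum_comp ⟨insertPoint_injective ha, insertPoint_surjective ha⟩
    (fun Q : Finpartition (insert a s) => f Q.parts.card), Fintype.sum_sigma]
  refine Finset.sum_congr rfl fun P _ => ?_
  rw [Fintype.sum_option]
  simp [card_insertPoint_none, card_insertPoint_some, stirlingOp]

end Partitions

/-- The sum of `f (number of blocks)` over all set partitions of `{1, ..., k}`. -/
def partitionSum (k : ℕ) (f : ℕ → ℕ) : ℕ :=
  ∑ P : Finpartition (Finset.Icc 1 k), f P.parts.card

lemma partitionSum_zero (f : ℕ → ℕ) : partitionSum 0 f = f 0 := by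
  have h (P : Finpartition (Finset.Icc 1 0)) : P.parts.card = 0 := by
    simp
  have : Unique (Finpartition (Finset.Icc 1 0)) :=
    inferInstanceAs (Unique (Finpartition (⊥ : Finset ℕ)))
  simp [partitionSum, h]

lemma partitionSum_succ (k : ℕ) (f : ℕ → ℕ) :
    partitionSum (k + 1) f = partitionSum k (stirlingOp f) := by
  have h : Finset.Icc 1 (k + 1) = insert (k + 1) (Finset.Icc 1 k) := by
    ext x; simp; omega
  rw [partitionSum, h]
  exact sum_finpartition_insert (by simp) f

lemma partitionSum_congr {k : ℕ} {f g : ℕ → ℕ} (h : ∀ t ≤ k, f t = g t) :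
    partitionSum k f = partitionSum k g :=
  Finset.sum_congr rfl fun P _ => h _ (by simpa using P.card_parts_le_card)

lemma partitionSum_eq_iterate (k : ℕ) (f : ℕ → ℕ) : partitionSum k f = stirlingOp^[k] f 0 := by
  induction k generalizing f with
  | zero => exact partitionSum_zero f
  | succ k ih => rw [partitionSum_succ, ih, Function.iterate_succ_apply]

lemma sum_stirling_mul {k : ℕ} (hk : 0 < k) (f : ℕ → ℕ) :
    ∑ j ∈ Finset.Icc 1 k, stirling k j * f j = partitionSum k f := by
  have hmem (P : Finpartition (Finset.Icc 1 k)) (_ : P ∈ Finset.univ) :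
      P.parts.card ∈ Finset.Icc 1 k := by
    refine Finset.mem_Icc.2 ⟨Finset.card_pos.2 ?_, by simpa using P.card_parts_le_card⟩
    exact P.parts_nonempty (Finset.nonempty_Icc.2 hk).ne_empty
  rw [partitionSum, ← Finset.sum_fiberwise_of_maps_to hmem]
  refine Finset.sum_congr rfl fun j _ => ?_
  rw [Finset.sum_congr rfl fun P hP => congrArg f (Finset.mem_filter.1 hP).2, Finset.sum_const,
    stirling, Nat.card_eq_fintype_card, Fintype.card_subtype, smul_eq_mul]

lemma iterate_stirlingOp_eq_partitionSum {f : ℕ → ℕ}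
    (hf : ∀ j, f (j + 1) = f j + j * f (j - 1)) (k j : ℕ) :
    stirlingOp^[k] f j = partitionSum k fun t => 2 ^ (k - t) * mulOp^[2 * t] f j := by
  induction k generalizing j with
  | zero => simp [partitionSum_zero]
  | succ k ih =>
    have hstep (t j : ℕ) : stirlingOp (mulOp^[2 * t] f) j =
        mulOp^[2 * (t + 1)] f j + 2 * t * mulOp^[2 * t] f j := by
      rw [stirlingOp_iterate_mulOp, stirlingOp_eq_mulOp_mulOp hf]
      rfl
    rw [Function.iterate_succ_apply', partitionSum_succ, stirlingOp, ih, ih]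
    simp only [partitionSum]
    rw [Finset.mul_sum, ← Finset.sum_add_distrib]
    refine partitionSum_congr (f := fun t => 2 ^ (k - t) * mulOp^[2 * t] f (j + 1) +
      j * (2 ^ (k - t) * mulOp^[2 * t] f j)) fun t ht => ?_
    have h := hstep t j
    rw [stirlingOp] at h
    rw [stirlingOp, Nat.add_sub_add_right, Nat.succ_sub ht, pow_succ]
    linear_combination 2 ^ (k - t) * h

end StirlingInvolution

theorem stirling_involution_sum_eq_stirling_two_pow_sum (k : ℕ) (hk : 0 < k) :
    ∑ j ∈ Finset.Icc 1 k, stirling k j * numInvolutions j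
      = ∑ t ∈ Finset.Icc 1 k, stirling k t * 2 ^ (k - t) := by
  open StirlingInvolution in
  rw [sum_stirling_mul hk, sum_stirling_mul hk, partitionSum_eq_iterate,
    iterate_stirlingOp_eq_partitionSum numInvolutions_succ]
  simp [iterate_mulOp_zero, numInvolutions_zero]
end

section
/- For every positive integer k, the number of pairs (B, σ), where B is a set partition of {1,2,...,k} and σ is an involution of the set of blocks of B (a bijection from the blocks of B to themselves whose square is the identity), equals the number of pairs (B', c), where B' is a set partition of {1,2,...,k} and c is a function from {1,...,k} to a two-element set {red, blue} such that the minimum element of every block of B' is colored red. -/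
namespace BlockInvolution

/-- A relation `s` is induced by an involution on the classes of the setoid `r`. -/
structure IsInvolutiveOn {α : Type*} (r : Setoid α) (s : α → α → Prop) : Prop where
  symm : ∀ x y, s x y → s y x
  total : ∀ x, ∃ y, s x y
  trans : ∀ x y z, s x y → s y z → r x z
  congr : ∀ x y z, r x y → s y z → s x z

/-- A coloring is admissible for a setoid if the least element of every class gets color `true`. -/
def IsAdmissible {α : Type*} [LE α] (t : Setoid α) (c : α → Bool) : Prop :=
  ∀ x, (∀ y, t x y → x ≤ y) → c x = true

/-- Involutions of the codomain of a surjection `f` correspond to relations on its domain that are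
involutive on the fibres of `f`. -/
noncomputable def involutionEquiv {α β : Type*} (f : α → β) (hf : Function.Surjective f) :
    {σ : Equiv.Perm β // σ * σ = 1} ≃ {s : α → α → Prop // IsInvolutiveOn (Setoid.ker f) s} :=
  Equiv.ofBijective
    (fun σ => ⟨fun x y => σ.1 (f x) = f y, by
      have h : ∀ b, σ.1 (σ.1 b) = b := fun b => Equiv.congr_fun σ.2 b
      refine ⟨fun x y hxy => ?_, fun x => ?_, fun x y z hxy hyz => ?_, fun x y z hxy hyz => ?_⟩
      · rw [← hxy, h]
      · obtain ⟨y, hy⟩ := hf (σ.1 (f x))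
        exact ⟨y, hy.symm⟩
      · rw [Setoid.ker_def, ← hyz, ← hxy, h]
      · rwa [Setoid.ker_def.1 hxy]⟩)
    (by
      constructor
      · rintro ⟨σ, hσ⟩ ⟨τ, hτ⟩ h
        ext b
        obtain ⟨x, rfl⟩ := hf b
        obtain ⟨y, hy⟩ := hf (σ (f x))
        have hxy := congr_fun (congr_fun (congr_arg Subtype.val h) x) y
        simp only [hy, eq_iff_iff, true_iff] at hxy
        exact hxy.symm
      · rintro ⟨s, hs⟩
        have key : ∀ b, ∃ b', ∀ x y, f x = b → (f y = b' ↔ s x y) := by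
          intro b
          obtain ⟨x, rfl⟩ := hf b
          obtain ⟨y, hxy⟩ := hs.total x
          refine ⟨f y, fun x' y' hx => ⟨fun hy => ?_, fun h => ?_⟩⟩
          · exact hs.symm _ _ (hs.congr _ _ _ hy (hs.symm _ _ (hs.congr _ _ _ hx hxy)))
          · exact (hs.trans _ _ _ (hs.symm _ _ hxy) (hs.congr _ _ _ hx.symm h)).symm
        choose g hg using key
        have hgg : Function.Involutive g := by
          intro b
          obtain ⟨x, rfl⟩ := hf b
          obtain ⟨y, hy⟩ := hf (g (f x))
          have hxy := (hg (f x) x y rfl).1 hy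
          rw [← hy]
          exact ((hg (f y) y x rfl).2 (hs.symm _ _ hxy)).symm
        refine ⟨⟨hgg.toPerm, Equiv.ext hgg⟩, ?_⟩
        ext x y
        exact eq_comm.trans (hg (f x) x y rfl))

section Correspondence

variable {α : Type*}

/-- Splitting every class by color. -/
def splitSetoid (t : Setoid α) (c : α → Bool) : Setoid α := t ⊓ Setoid.ker c

/-- Exchanging the two colors in every class that has both of them. -/
def colorSwap (t : Setoid α) (c : α → Bool) (x y : α) : Prop :=
  t x y ∧ (c x = c y → ∀ z, t x z → c z = c x)

theorem splitSetoid_apply {t : Setoid α} {c : α → Bool} {x y : α} :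
    splitSetoid t c x y ↔ t x y ∧ c x = c y := Iff.rfl

theorem isInvolutiveOn_colorSwap (t : Setoid α) (c : α → Bool) :
    IsInvolutiveOn (splitSetoid t c) (colorSwap t c) := by
  have t1 : ∀ {x y}, t x y → t y x := t.symm
  have t2 : ∀ {x y z}, t x y → t y z → t x z := t.trans
  have t0 := t.refl
  refine ⟨?_, fun x => ?_, ?_, ?_⟩
  · rintro x y ⟨hxy, h⟩
    exact ⟨t1 hxy, fun hc z hz => (h hc.symm z (t2 hxy hz)).trans hc.symm⟩
  · by_cases h : ∃ y, t x y ∧ c y ≠ c x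
    · obtain ⟨y, hy, hc⟩ := h
      exact ⟨y, hy, fun h => absurd h.symm hc⟩
    · push Not at h
      exact ⟨x, t0 x, fun _ => h⟩
  · rintro x y z ⟨hxy, h⟩ ⟨hyz, h'⟩
    refine ⟨t2 hxy hyz, ?_⟩
    change c x = c z
    by_cases hc : c x = c y
    · exact (h hc z (t2 hxy hyz)).symm
    · by_cases hc' : c y = c z
      · exact absurd (h' hc' x (t1 hxy)) hc
      · revert hc hc'
        cases c x <;> cases c y <;> cases c z <;> simp
  · rintro x y z ⟨hxy, hc⟩ ⟨hyz, h⟩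
    change c x = c y at hc
    exact ⟨t2 hxy hyz, fun hc' w hw => hc ▸ h (hc ▸ hc') w (t2 (t1 hxy) hw)⟩

variable [LinearOrder α]

/-- Merging every class with its image under the involution. -/
def mergedSetoid {r : Setoid α} {s : α → α → Prop} (h : IsInvolutiveOn r s) : Setoid α where
  r x y := r x y ∨ s x y
  iseqv := by
    have h1 := h.symm
    have h2 := h.trans
    have h3 := h.congr
    refine ⟨fun x => Or.inl (r.refl x), ?_, ?_⟩
    · rintro x y (hxy | hxy)
      · exact Or.inl (r.symm hxy)
      · exact Or.inr (h1 _ _ hxy)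
    · rintro x y z (hxy | hxy) (hyz | hyz)
      · exact Or.inl (r.trans hxy hyz)
      · exact Or.inr (h3 _ _ _ hxy hyz)
      · exact Or.inr (h1 _ _ (h3 _ _ _ (r.symm hyz) (h1 _ _ hxy)))
      · exact Or.inl (h2 _ _ _ hxy hyz)

open Classical in
/-- An element gets color `true` if the minimum of its class is at most that of the image class. -/
noncomputable def minColor (r : Setoid α) (s : α → α → Prop) (x : α) : Bool :=
  decide (∃ y, r x y ∧ ∀ z, s x z → y ≤ z)

theorem minColor_eq_true {r : Setoid α} {s : α → α → Prop} {x : α} :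
    minColor r s x = true ↔ ∃ y, r x y ∧ ∀ z, s x z → y ≤ z := by
  simp [minColor]

theorem minColor_congr {r : Setoid α} {s : α → α → Prop} (h : IsInvolutiveOn r s) {x y : α}
    (hxy : r x y) : minColor r s x = minColor r s y := by
  rw [Bool.eq_iff_iff, minColor_eq_true, minColor_eq_true]
  exact ⟨fun ⟨m, hm, hle⟩ => ⟨m, r.trans (r.symm hxy) hm, fun z hz => hle z (h.congr _ _ _ hxy hz)⟩,
    fun ⟨m, hm, hle⟩ => ⟨m, r.trans hxy hm, fun z hz => hle z (h.congr _ _ _ (r.symm hxy) hz)⟩⟩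

theorem rel_of_minColor {r : Setoid α} {s : α → α → Prop} (h : IsInvolutiveOn r s) {x y : α}
    (hxy : s x y) (hx : minColor r s x = true) (hy : minColor r s y = true) : r x y := by
  obtain ⟨m, hxm, hm⟩ := minColor_eq_true.1 hx
  obtain ⟨n, hyn, hn⟩ := minColor_eq_true.1 hy
  have hxn : s x n := h.symm _ _ (h.congr _ _ _ (r.symm hyn) (h.symm _ _ hxy))
  have hym : s y m := h.symm _ _ (h.congr _ _ _ (r.symm hxm) hxy)
  obtain rfl : m = n := le_antisymm (hm _ hxn) (hn _ hym)
  exact r.trans hxm (r.symm hyn)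

theorem exists_least [WellFoundedLT α] (t : Setoid α) (x : α) :
    ∃ m, t x m ∧ ∀ z, t x z → m ≤ z := by
  obtain ⟨m, hm, hle⟩ := WellFounded.has_min (wellFounded_lt (α := α)) {y | t x y} ⟨x, t.refl x⟩
  exact ⟨m, hm, fun z hz => not_lt.1 (hle z hz)⟩

theorem minColor_or [WellFoundedLT α] {r : Setoid α} {s : α → α → Prop} (h : IsInvolutiveOn r s)
    {x y : α} (hxy : s x y) : minColor r s x = true ∨ minColor r s y = true := by
  obtain ⟨m, hm | hm, hle⟩ := exists_least (mergedSetoid h) x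
  · exact Or.inl (minColor_eq_true.2 ⟨m, hm, fun z hz => hle z (Or.inr hz)⟩)
  · refine Or.inr (minColor_eq_true.2 ⟨m, h.trans _ _ _ (h.symm _ _ hxy) hm, fun z hz => ?_⟩)
    exact hle z (Or.inl (h.trans _ _ _ hxy hz))

theorem isAdmissible_minColor {r : Setoid α} {s : α → α → Prop} (h : IsInvolutiveOn r s) :
    IsAdmissible (mergedSetoid h) (minColor r s) :=
  fun x hx => minColor_eq_true.2 ⟨x, r.refl x, fun z hz => hx z (Or.inr hz)⟩

/-- Involutive relations on the classes of a setoid correspond to admissibly colored setoids. -/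
noncomputable def correspondence [WellFoundedLT α] :
    {p : Setoid α × (α → α → Prop) // IsInvolutiveOn p.1 p.2} ≃
      {p : Setoid α × (α → Bool) // IsAdmissible p.1 p.2} where
  toFun p := ⟨(mergedSetoid p.2, minColor p.1.1 p.1.2), isAdmissible_minColor p.2⟩
  invFun p := ⟨(splitSetoid p.1.1 p.1.2, colorSwap p.1.1 p.1.2), isInvolutiveOn_colorSwap _ _⟩
  left_inv := by
    rintro ⟨⟨r, s⟩, h⟩
    change IsInvolutiveOn r s at h
    have hrel : ∀ {x y}, s x y → minColor r s x = minColor r s y → r x y := by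
      intro x y hxy hc
      rcases minColor_or h hxy with hx | hy
      · exact rel_of_minColor h hxy hx (hc ▸ hx)
      · exact rel_of_minColor h hxy (hc ▸ hy) hy
    refine Subtype.ext (Prod.ext (Setoid.ext fun x y => ?_) (funext₂ fun x y => propext ?_))
    · refine ⟨?_, fun hxy => ⟨Or.inl hxy, minColor_congr h hxy⟩⟩
      rintro ⟨hxy | hxy, hc⟩
      · exact hxy
      · exact hrel hxy hc
    · constructor
      · rintro ⟨hxy | hxy, hc⟩
        · obtain ⟨w, hw⟩ := h.total x
          have hxw := hrel hw (hc (minColor_congr h hxy) w (Or.inr hw)).symm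
          exact h.symm _ _ (h.congr _ _ _ (r.trans (r.symm hxy) hxw) (h.symm _ _ hw))
        · exact hxy
      · intro hxy
        refine ⟨Or.inr hxy, fun hc z hz => ?_⟩
        have hr := hrel hxy hc
        rcases hz with hz | hz
        · exact (minColor_congr h hz).symm
        · exact (minColor_congr h (r.trans hr (h.trans _ _ _ (h.symm _ _ hxy) hz))).symm
  right_inv := by
    rintro ⟨⟨t, c⟩, h⟩
    change IsAdmissible t c at h
    refine Subtype.ext (Prod.ext (Setoid.ext fun x y => ?_) (funext fun x => ?_))
    · refine ⟨?_, fun hxy => ?_⟩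
      · rintro (hxy | hxy)
        exacts [hxy.1, hxy.1]
      · by_cases hc : c x = c y
        · exact Or.inl ⟨hxy, hc⟩
        · exact Or.inr ⟨hxy, fun hc' => absurd hc' hc⟩
    · obtain ⟨m, hxm, hm⟩ := exists_least t x
      have hcm : c m = true := h m fun z hz => hm z (t.trans hxm hz)
      change minColor (splitSetoid t c) (colorSwap t c) x = c x
      rw [Bool.eq_iff_iff, minColor_eq_true]
      constructor
      · rintro ⟨y, hxy, hy⟩
        obtain ⟨hxy, hc⟩ := splitSetoid_apply.1 hxy
        by_contra hx
        have hym := hy m ⟨hxm, fun hc' => absurd (hc'.trans hcm) hx⟩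
        obtain rfl := le_antisymm hym (hm y hxy)
        exact hx (hc.trans hcm)
      · exact fun hx => ⟨m, ⟨hxm, hx.trans hcm.symm⟩, fun z hz => hm z hz.1⟩

end Correspondence

section Finpartition

variable {α : Type*} [DecidableEq α] {s : Finset α}

/-- The part of a finpartition containing a given element. -/
def partOf (B : Finpartition s) (x : {x // x ∈ s}) : {p // p ∈ B.parts} :=
  ⟨B.part x, B.part_mem.2 x.2⟩

theorem partOf_surjective (B : Finpartition s) : Function.Surjective (partOf B) := by
  rintro ⟨p, hp⟩
  obtain ⟨x, hx, rfl⟩ := B.part_surjOn hp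
  exact ⟨⟨x, hx⟩, rfl⟩

theorem ker_partOf {B : Finpartition s} {x y : {x // x ∈ s}} :
    Setoid.ker (partOf B) x y ↔ (y : α) ∈ B.part x := by
  rw [B.mem_part_iff_part_eq_part y.2 x.2, Setoid.ker_def, partOf, partOf, Subtype.mk.injEq,
    eq_comm]

theorem ker_partOf_bijective :
    Function.Bijective fun B : Finpartition s => Setoid.ker (partOf B) := by
  classical
  constructor
  · intro B C h
    have hpart : ∀ x ∈ s, B.part x = C.part x := by
      intro x hx
      ext y
      by_cases hy : y ∈ s
      · have := Setoid.ext_iff.1 h ⟨x, hx⟩ ⟨y, hy⟩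
        rwa [ker_partOf, ker_partOf] at this
      · exact iff_of_false (fun h => hy (B.part_subset x h)) (fun h => hy (C.part_subset x h))
    refine Finpartition.ext (Finset.ext fun p => ⟨fun hp => ?_, fun hp => ?_⟩)
    · obtain ⟨x, hx, rfl⟩ := B.part_surjOn hp
      rw [hpart x hx]
      exact C.part_mem.2 hx
    · obtain ⟨x, hx, rfl⟩ := C.part_surjOn hp
      rw [← hpart x hx]
      exact B.part_mem.2 hx
  · intro r
    let t : Setoid α :=
      { r := fun x y => x = y ∨ ∃ (hx : x ∈ s) (hy : y ∈ s), r ⟨x, hx⟩ ⟨y, hy⟩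
        iseqv := by
          refine ⟨fun x => Or.inl rfl, ?_, ?_⟩
          · rintro x y (rfl | ⟨hx, hy, h⟩)
            · exact Or.inl rfl
            · exact Or.inr ⟨hy, hx, r.symm h⟩
          · rintro x y z (rfl | ⟨hx, hy, h⟩) (rfl | ⟨hy', hz, h'⟩)
            · exact Or.inl rfl
            · exact Or.inr ⟨hy', hz, h'⟩
            · exact Or.inr ⟨hx, hy, h⟩
            · exact Or.inr ⟨hx, hz, r.trans h h'⟩ }
    refine ⟨Finpartition.ofSetSetoid t s, Setoid.ext fun x y => ?_⟩
    rw [ker_partOf, Finpartition.mem_part_ofSetSetoid_iff_rel]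
    constructor
    · rintro ⟨-, -, h | ⟨_, _, h⟩⟩
      · rw [Subtype.ext h]
      · exact h
    · exact fun h => ⟨x.2, y.2, Or.inr ⟨x.2, y.2, h⟩⟩

theorem isAdmissible_ker_partOf [LE α] {B : Finpartition s} {c : {x // x ∈ s} → Bool} :
    IsAdmissible (Setoid.ker (partOf B)) c ↔
      ∀ p ∈ B.parts, ∀ x, ∀ hx : x ∈ s, x ∈ p → (∀ y ∈ p, x ≤ y) → c ⟨x, hx⟩ = true := by
  constructor
  · intro h p hp x hx hxp hle
    refine h ⟨x, hx⟩ fun y hy => hle y ?_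
    rwa [ker_partOf, B.part_eq_of_mem hp hxp] at hy
  · intro h x hx
    refine h (B.part x) (B.part_mem.2 x.2) x x.2 (B.mem_part x.2) fun y hy => ?_
    exact hx ⟨y, B.part_subset _ hy⟩ (ker_partOf.2 hy)

end Finpartition

end BlockInvolution

open BlockInvolution in
theorem card_partitions_with_block_involution_eq_card_bicolored_partitions
    (k : ℕ) (hk : 0 < k) :
    Nat.card ((B : Finpartition (Finset.Icc 1 k)) ×
        {σ : Equiv.Perm {p // p ∈ B.parts} // σ * σ = 1})
      = Nat.card ((B : Finpartition (Finset.Icc 1 k)) ×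
        {c : {x // x ∈ Finset.Icc 1 k} → Bool //
          ∀ p ∈ B.parts, ∀ x, ∀ hx : x ∈ Finset.Icc 1 k,
            x ∈ p → (∀ y ∈ p, x ≤ y) → c ⟨x, hx⟩ = true}) := by
  let e := Equiv.ofBijective _ (ker_partOf_bijective (s := Finset.Icc 1 k))
  let e₁ := (Equiv.sigmaCongr (β₂ := fun r => {s // IsInvolutiveOn r s}) e
    fun B => involutionEquiv (partOf B) (partOf_surjective B)).trans
      (Equiv.subtypeProdEquivSigmaSubtype IsInvolutiveOn).symm
  let e₂ := (Equiv.sigmaCongr (β₂ := fun t => {c // IsAdmissible t c}) e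
    fun B => Equiv.subtypeEquivRight fun c => (isAdmissible_ker_partOf (B := B) (c := c)).symm).trans
      (Equiv.subtypeProdEquivSigmaSubtype IsAdmissible).symm
  exact Nat.card_congr (e₁.trans (correspondence.trans e₂.symm))
end

section
/- For every positive integer k, the number of limiting vacillating tableaux of length 2k equals ∑_{j=1}^{k} S(k,j) · (∑_{λ ⊢ j} f^λ), where the inner sum of f^λ over integer partitions λ of j is the total number of standard Young tableaux with j boxes. -/
/-- A limiting vacillating tableau of length `2k`: a sequence of Young diagrams
`(λ⁽⁰⁾, λ⁽¹ᐟ²⁾, λ⁽¹⁾, ..., λ⁽ᵏ⁾)` where `lam j` is `λ⁽ʲ⁾` for integers `j` and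
`mu j` is `λ⁽ʲ⁺¹ᐟ²⁾`, such that `λ⁽⁰⁾ = ∅`, each half step does nothing or deletes
one box, and each full step adds exactly one box. -/
structure LimitingVacillatingTableau (k : ℕ) where
  lam : Fin (k + 1) → YoungDiagram
  mu : Fin k → YoungDiagram
  init : lam 0 = ⊥
  half_step : ∀ j : Fin k,
    mu j = lam j.castSucc ∨
      (mu j ≤ lam j.castSucc ∧ (lam j.castSucc).card = (mu j).card + 1)
  full_step : ∀ j : Fin k,
    mu j ≤ lam j.succ ∧ (lam j.succ).card = (mu j).card + 1

/-- `sytCount μ` is `f^μ`, the number of standard Young tableaux of shape `μ`,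
counted as chains `∅ = c 0 ⊂ c 1 ⊂ ... ⊂ c |μ| = μ` of Young diagrams, each
obtained from the previous one by adding a single box. -/
noncomputable def sytCount (μ : YoungDiagram) : ℕ :=
  Nat.card {c : Fin (μ.card + 1) → YoungDiagram //
    c 0 = ⊥ ∧ c (Fin.last μ.card) = μ ∧
    ∀ i : Fin μ.card,
      c i.castSucc ≤ c i.succ ∧ (c i.succ).card = (c i.castSucc).card + 1}

namespace Setoid

/-- The extension of `r` to `Option α` in which `none` joins the class `q` if `o = some q`, or
forms a class of its own if `o = none`, where `o` is the second argument. -/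
def optionExtend {α : Type*} (r : Setoid α) : Option (Quotient r) → Setoid (Option α)
  | none => ker (Option.map (Quotient.mk r))
  | some q => ker (fun x : Option α => x.elim q (Quotient.mk r))

theorem optionExtend_some_some {α : Type*} (r : Setoid α) (o : Option (Quotient r)) (x y : α) :
    r.optionExtend o (some x) (some y) ↔ r x y := by
  cases o with
  | none => exact Option.some_inj.trans Quotient.eq
  | some q => exact Quotient.eq

theorem optionExtend_none_some {α : Type*} (r : Setoid α) (o : Option (Quotient r)) (x : α) :
    r.optionExtend o none (some x) ↔ o = some (Quotient.mk r x) := by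
  cases o with
  | none => exact iff_of_false (fun h => nomatch h) (fun h => nomatch h)
  | some q => exact Option.some_inj.symm

theorem card_quotient_optionExtend {α : Type*} [Finite α] (r : Setoid α)
    (o : Option (Quotient r)) :
    Nat.card (Quotient (r.optionExtend o)) =
      Nat.card (Quotient r) + if o = none then 1 else 0 := by
  cases o with
  | none =>
    have hs : Function.Surjective (Option.map (Quotient.mk r)) :=
      fun z => by
        rcases z with _ | z
        · exact ⟨none, rfl⟩
        · obtain ⟨x, rfl⟩ := Quotient.mk_surjective z
          exact ⟨some x, rfl⟩
    rw [if_pos rfl, ← Finite.card_option]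
    exact Nat.card_congr (quotientKerEquivOfSurjective _ hs)
  | some q =>
    have hs : Function.Surjective (fun x : Option α => x.elim q (Quotient.mk r)) := fun z => by
      obtain ⟨x, rfl⟩ := Quotient.mk_surjective z
      exact ⟨some x, rfl⟩
    rw [if_neg (by simp), add_zero]
    exact Nat.card_congr (quotientKerEquivOfSurjective _ hs)

theorem optionExtend_bijective (α : Type*) :
    Function.Bijective
      (fun p : Σ r : Setoid α, Option (Quotient r) => p.1.optionExtend p.2) := by
  constructor
  · rintro ⟨r, o⟩ ⟨r', o'⟩ h
    replace h : r.optionExtend o = r'.optionExtend o' := h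
    obtain rfl : r = r' := by
      ext x y
      rw [← optionExtend_some_some r o, h, optionExtend_some_some]
    have key : ∀ q, o = some q ↔ o' = some q := fun q => by
      obtain ⟨x, rfl⟩ := Quotient.mk_surjective q
      rw [← optionExtend_none_some, h, optionExtend_none_some]
    obtain rfl : o = o' := Option.ext key
    rfl
  · intro R
    let r : Setoid α := R.comap some
    have main : ∀ o : Option (Quotient r),
        (∀ x, o = some (Quotient.mk r x) ↔ R none (some x)) → r.optionExtend o = R := by
      intro o ho
      ext x y
      rcases x with _ | x <;> rcases y with _ | y
      · exact iff_of_true (refl' _ _) (refl' _ _)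
      · rw [optionExtend_none_some, ho]
      · rw [Setoid.comm', optionExtend_none_some, ho, Setoid.comm']
      · rw [optionExtend_some_some]
        rfl
    by_cases h : ∃ x, R none (some x)
    · obtain ⟨x, hx⟩ := h
      refine ⟨⟨r, some (Quotient.mk r x)⟩, main _ fun y => ?_⟩
      rw [Option.some_inj, Quotient.eq]
      exact ⟨fun hxy => R.trans' hx hxy, fun hy => R.trans' (R.symm' hx) hy⟩
    · refine ⟨⟨r, none⟩, main _ fun y => ?_⟩
      simpa using fun hy => h ⟨y, hy⟩

/-- The number of equivalence relations on `α` with exactly `j` classes. -/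
noncomputable def cardWithClasses (α : Type*) (j : ℕ) : ℕ :=
  Nat.card {r : Setoid α // Nat.card (Quotient r) = j}

theorem comap_equiv_bijective {α β : Type*} (e : α ≃ β) :
    Function.Bijective (fun r : Setoid β => r.comap e) := by
  refine ⟨fun r s h => ?_, fun r => ⟨r.comap e.symm, ?_⟩⟩
  · ext x y
    have := Setoid.ext_iff.1 h (e.symm x) (e.symm y)
    simpa [comap_rel] using this
  · ext x y
    simp [comap_rel]

theorem cardWithClasses_congr {α β : Type*} (e : α ≃ β) (j : ℕ) :
    cardWithClasses α j = cardWithClasses β j := by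
  refine (Nat.card_congr
    ((Equiv.ofBijective _ (comap_equiv_bijective e)).subtypeEquiv fun r => ?_)).symm
  rw [Equiv.ofBijective_apply,
    Nat.card_congr (Quotient.congr (ra := r.comap e) (rb := r) e fun _ _ => Iff.rfl)]

theorem cardWithClasses_option (α : Type*) [Finite α] (j : ℕ) :
    cardWithClasses (Option α) (j + 1) =
      (j + 1) * cardWithClasses α (j + 1) + cardWithClasses α j := by
  classical
  have : Finite (Setoid α) := Finite.of_injective (fun r : Setoid α => r.r)
    fun r s h => Setoid.ext fun x y => iff_of_eq (congrFun₂ h x y)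
  have := Fintype.ofFinite (Setoid α)
  have : ∀ r : Setoid α, Fintype (Quotient r) := fun r => Fintype.ofFinite _
  unfold cardWithClasses
  rw [← Nat.card_congr ((Equiv.ofBijective _ (optionExtend_bijective α)).subtypeEquiv
    (p := fun p => Nat.card (Quotient (p.1.optionExtend p.2)) = j + 1) fun p => Iff.rfl)]
  simp only [card_quotient_optionExtend, Nat.card_eq_fintype_card, Fintype.card_subtype]
  rw [Finset.card_filter, ← Finset.univ_sigma_univ, Finset.sum_sigma, Finset.card_filter,
    Finset.card_filter, Finset.mul_sum, ← Finset.sum_add_distrib]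
  refine Finset.sum_congr rfl fun r _ => ?_
  rw [Fintype.sum_option]
  by_cases h : Fintype.card (Quotient r) = j + 1 <;> simp [h, add_comm]

theorem cardWithClasses_fin (k j : ℕ) : cardWithClasses (Fin k) j = Nat.stirlingSecond k j := by
  induction k generalizing j with
  | zero =>
    have : Unique (Setoid (Fin 0)) := ⟨⟨⊥⟩, fun r => Setoid.ext fun x => x.elim0⟩
    have h0 : ∀ r : Setoid (Fin 0), Nat.card (Quotient r) = 0 := fun r =>
      Nat.card_eq_zero.2 (.inl ⟨fun q => by
        obtain ⟨x, -⟩ := Quotient.mk_surjective q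
        exact x.elim0⟩)
    simp only [cardWithClasses, h0]
    cases j with
    | zero => simp
    | succ j => simp
  | succ k ih =>
    rw [cardWithClasses_congr (finSuccEquiv k)]
    cases j with
    | zero =>
      have : ∀ r : Setoid (Option (Fin k)), Nonempty (Quotient r) := fun r => ⟨Quotient.mk r none⟩
      simp [cardWithClasses, Nat.card_pos.ne']
    | succ j => rw [cardWithClasses_option, ih, ih, Nat.stirlingSecond_succ_succ]

end Setoid

namespace Finpartition

theorem part_eq_part_iff {α : Type*} [DecidableEq α] {s : Finset α} (P : Finpartition s) {x y : α}
    (hx : x ∈ s) (hy : y ∈ s) : P.part x = P.part y ↔ x ∈ P.part y :=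
  (P.mem_part_iff_part_eq_part hx hy).symm

theorem ker_part_bijective {α : Type*} [DecidableEq α] (s : Finset α) :
    Function.Bijective
      (fun P : Finpartition s => Setoid.ker (fun x : s => P.part (x : α))) := by
  classical
  constructor
  · intro P Q h
    have hPQ : ∀ x ∈ s, P.part x = Q.part x := fun x hx => by
      ext y
      by_cases hy : y ∈ s
      · rw [← P.part_eq_part_iff hy hx, ← Q.part_eq_part_iff hy hx]
        exact Setoid.ext_iff.1 h ⟨y, hy⟩ ⟨x, hx⟩
      · exact iff_of_false (fun h => hy (P.part_subset x h)) fun h => hy (Q.part_subset x h)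
    have parts_eq : ∀ R : Finpartition s, R.parts = s.image R.part := fun R => by
      ext t
      rw [Finset.mem_image]
      refine ⟨fun ht => R.part_surjOn ht, ?_⟩
      rintro ⟨x, hx, rfl⟩
      exact R.part_mem.2 hx
    apply Finpartition.ext
    rw [parts_eq, parts_eq, Finset.image_congr hPQ]
  · intro R
    let g : α → Option (Quotient R) := fun x =>
      if h : x ∈ s then some (Quotient.mk R ⟨x, h⟩) else none
    refine ⟨ofSetSetoid (Setoid.ker g) s, ?_⟩
    ext x y
    change (ofSetSetoid (Setoid.ker g) s).part (x : α) =
      (ofSetSetoid (Setoid.ker g) s).part (y : α) ↔ _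
    rw [part_eq_part_iff _ x.2 y.2, mem_part_ofSetSetoid_iff_rel, Setoid.ker_def]
    simp [g, Quotient.eq, Setoid.comm']

theorem card_quotient_ker_part {α : Type*} [DecidableEq α] {s : Finset α} (P : Finpartition s) :
    Nat.card (Quotient (Setoid.ker (fun x : s => P.part (x : α)))) = P.parts.card := by
  rw [Nat.card_congr (Setoid.quotientKerEquivRange _)]
  have h : Set.range (fun x : s => P.part (x : α)) = P.parts := by
    ext t
    refine ⟨?_, fun ht => ?_⟩
    · rintro ⟨x, rfl⟩
      exact P.part_mem.2 x.2
    · obtain ⟨x, hx, rfl⟩ := P.part_surjOn ht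
      exact ⟨⟨x, hx⟩, rfl⟩
  rw [h]
  simp

end Finpartition

theorem stirling_eq_stirlingSecond (k j : ℕ) : stirling k j = Nat.stirlingSecond k j := by
  have e : Finset.Icc 1 k ≃ Fin k := Finset.equivFinOfCardEq (by simp)
  rw [← Setoid.cardWithClasses_fin, ← Setoid.cardWithClasses_congr e]
  refine Nat.card_congr ((Equiv.ofBijective _ (Finpartition.ker_part_bijective _)).subtypeEquiv
    fun P => ?_)
  rw [Equiv.ofBijective_apply, Finpartition.card_quotient_ker_part]

namespace YoungDiagram

theorem card_mono {μ ν : YoungDiagram} (h : μ ≤ ν) : μ.card ≤ ν.card :=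
  Finset.card_le_card h

theorem eq_of_le_of_card_le {μ ν : YoungDiagram} (h : μ ≤ ν) (hc : ν.card ≤ μ.card) : μ = ν :=
  YoungDiagram.ext (Finset.eq_of_subset_of_card_le h hc)

theorem card_sup_add_card_inf (μ ν : YoungDiagram) :
    (μ ⊔ ν).card + (μ ⊓ ν).card = μ.card + ν.card :=
  Finset.card_union_add_card_inter μ.cells ν.cells

theorem card_eq_zero {μ : YoungDiagram} : μ.card = 0 ↔ μ = ⊥ := by
  rw [YoungDiagram.card, Finset.card_eq_zero, YoungDiagram.ext_iff, cells_bot]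

theorem fst_lt_card {μ : YoungDiagram} {c : ℕ × ℕ} (h : c ∈ μ) : c.1 < μ.card :=
  (mem_iff_lt_colLen.1 h).trans_le
    ((colLen_eq_card μ).trans_le (Finset.card_le_card (Finset.filter_subset _ _)))

theorem snd_lt_card {μ : YoungDiagram} {c : ℕ × ℕ} (h : c ∈ μ) : c.2 < μ.card :=
  (mem_iff_lt_rowLen.1 h).trans_le
    ((rowLen_eq_card μ).trans_le (Finset.card_le_card (Finset.filter_subset _ _)))

theorem finite_card_le (n : ℕ) : {μ : YoungDiagram | μ.card ≤ n}.Finite := by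
  refine Set.Finite.of_injOn (f := cells) (t := ↑(Finset.range n ×ˢ Finset.range n).powerset)
    (fun μ hμ => ?_) (fun μ _ ν _ h => YoungDiagram.ext h) (Finset.finite_toSet _)
  rw [Finset.mem_coe, Finset.mem_powerset]
  intro c hc
  rw [Finset.mem_product, Finset.mem_range, Finset.mem_range]
  exact ⟨(fst_lt_card hc).trans_le hμ, (snd_lt_card hc).trans_le hμ⟩

/-- The Young diagrams obtained from `μ` by adding one box. -/
noncomputable def upper (μ : YoungDiagram) : Finset YoungDiagram :=
  Set.Finite.toFinset (s := {ν | μ ≤ ν ∧ ν.card = μ.card + 1})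
    ((finite_card_le (μ.card + 1)).subset fun _ h => h.2.le)

/-- The Young diagrams obtained from `μ` by deleting one box. -/
noncomputable def lower (μ : YoungDiagram) : Finset YoungDiagram :=
  Set.Finite.toFinset (s := {ν | ν ≤ μ ∧ μ.card = ν.card + 1})
    ((finite_card_le μ.card).subset fun _ h => card_mono h.1)

theorem mem_upper {μ ν : YoungDiagram} : ν ∈ μ.upper ↔ μ ≤ ν ∧ ν.card = μ.card + 1 := by
  simp [upper]

theorem mem_lower {μ ν : YoungDiagram} : ν ∈ μ.lower ↔ ν ≤ μ ∧ μ.card = ν.card + 1 := by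
  simp [lower]

theorem notMem_upper (μ : YoungDiagram) : μ ∉ μ.upper := fun h => by
  have := (mem_upper.1 h).2
  omega

theorem exists_insert_cells_eq {μ ν : YoungDiagram} (h : μ ≤ ν) (hc : ν.card = μ.card + 1) :
    ∃ c ∉ μ, insert c μ.cells = ν.cells :=
  Finset.exists_eq_insert_iff.2 ⟨h, hc.symm⟩

/-- Adding a box at the end of row `i`. -/
def addBox (μ : YoungDiagram) (i : ℕ) (h : i = 0 ∨ μ.rowLen i < μ.rowLen (i - 1)) :
    YoungDiagram where
  cells := insert (i, μ.rowLen i) μ.cells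
  isLowerSet := by
    rintro ⟨a, b⟩ ⟨a', b'⟩ hle hab
    obtain ⟨ha, hb⟩ := Prod.mk_le_mk.1 hle
    simp only [Finset.coe_insert, Set.mem_insert_iff, Finset.mem_coe, mem_cells, Prod.mk.injEq,
      mem_iff_lt_rowLen] at hab ⊢
    have h1 := μ.rowLen_anti a' a ha
    rcases hab with ⟨rfl, rfl⟩ | hab
    · by_cases hai : a' = a
      · subst hai; omega
      · have h2 := μ.rowLen_anti a' (a - 1) (by omega)
        omega
    · omega

/-- Deleting the box at the end of row `i`. -/
def removeBox (μ : YoungDiagram) (i : ℕ) (h : μ.rowLen (i + 1) < μ.rowLen i) : YoungDiagram where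
  cells := μ.cells.erase (i, μ.rowLen i - 1)
  isLowerSet := by
    rintro ⟨a, b⟩ ⟨a', b'⟩ hle hab
    obtain ⟨ha, hb⟩ := Prod.mk_le_mk.1 hle
    simp only [Finset.coe_erase, Set.mem_sdiff, Finset.mem_coe, mem_cells, Prod.mk.injEq,
      mem_iff_lt_rowLen, Set.mem_singleton_iff] at hab ⊢
    have h1 := μ.rowLen_anti a' a ha
    refine ⟨by omega, ?_⟩
    rintro ⟨rfl, rfl⟩
    by_cases hai : a = a'
    · subst hai; omega
    · have h2 := μ.rowLen_anti (a' + 1) a (by omega)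
      omega

theorem card_upper_eq_card_filter (μ : YoungDiagram) :
    μ.upper.card = ((Finset.range (μ.card + 1)).filter
      fun i => i = 0 ∨ μ.rowLen i < μ.rowLen (i - 1)).card := by
  symm
  refine Finset.card_bij (fun i hi => μ.addBox i (Finset.mem_filter.1 hi).2) ?_ ?_ ?_
  · intro i hi
    rw [mem_upper]
    exact ⟨Finset.subset_insert _ _, Finset.card_insert_of_notMem (by simp [mem_iff_lt_rowLen])⟩
  · intro i hi i' hi' h
    have hmem : (i, μ.rowLen i) ∈ (μ.addBox i' (Finset.mem_filter.1 hi').2).cells := by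
      rw [← h]
      exact Finset.mem_insert_self _ _
    rcases Finset.mem_insert.1 hmem with h | h
    · exact congrArg Prod.fst h
    · simp [mem_iff_lt_rowLen] at h
  · intro ν hν
    obtain ⟨hle, hc⟩ := mem_upper.1 hν
    obtain ⟨⟨i, j⟩, hij, hins⟩ := exists_insert_cells_eq hle hc
    have hmem : ∀ a b, (a, b) ∈ ν ↔ (a = i ∧ b = j) ∨ (a, b) ∈ μ := fun a b => by
      rw [← mem_cells, ← hins]
      simp
    have hν : (i, j) ∈ ν := (hmem i j).2 (.inl ⟨rfl, rfl⟩)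
    have hj : j = μ.rowLen i := by
      rw [mem_iff_lt_rowLen] at hij
      by_contra hne
      have := (hmem i (μ.rowLen i)).1 (ν.up_left_mem le_rfl (by omega) hν)
      rw [mem_iff_lt_rowLen] at this
      omega
    have hi : i = 0 ∨ μ.rowLen i < μ.rowLen (i - 1) := by
      by_cases h0 : i = 0
      · exact .inl h0
      · have := (hmem (i - 1) j).1 (ν.up_left_mem (by omega) le_rfl hν)
        rw [mem_iff_lt_rowLen] at this
        omega
    have hlt : i < μ.card + 1 := by
      rcases hi with h | h
      · omega
      · have := fst_lt_card (mem_iff_lt_rowLen.2 h)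
        simp only at this
        omega
    refine ⟨i, Finset.mem_filter.2 ⟨Finset.mem_range.2 hlt, hi⟩, YoungDiagram.ext ?_⟩
    rw [← hins, hj]
    rfl

theorem card_lower_eq_card_filter (μ : YoungDiagram) :
    μ.lower.card = ((Finset.range μ.card).filter
      fun i => μ.rowLen (i + 1) < μ.rowLen i).card := by
  symm
  have last_mem : ∀ i, μ.rowLen (i + 1) < μ.rowLen i → (i, μ.rowLen i - 1) ∈ μ := fun i hi => by
    rw [mem_iff_lt_rowLen]
    omega
  refine Finset.card_bij (fun i hi => μ.removeBox i (Finset.mem_filter.1 hi).2) ?_ ?_ ?_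
  · intro i hi
    rw [mem_lower]
    exact ⟨Finset.erase_subset _ _,
      (Finset.card_erase_add_one (last_mem i (Finset.mem_filter.1 hi).2)).symm⟩
  · intro i hi i' hi' h
    have hmem : (i, μ.rowLen i - 1) ∉ (μ.removeBox i' (Finset.mem_filter.1 hi').2).cells := by
      rw [← h]
      exact Finset.notMem_erase _ _
    by_contra hne
    exact hmem (Finset.mem_erase.2
      ⟨fun h => hne (congrArg Prod.fst h), last_mem i (Finset.mem_filter.1 hi).2⟩)
  · intro κ hκ
    obtain ⟨hle, hc⟩ := mem_lower.1 hκ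
    obtain ⟨⟨i, j⟩, hij, hins⟩ := exists_insert_cells_eq hle hc
    have hmem : ∀ a b, (a, b) ∈ μ ↔ (a = i ∧ b = j) ∨ (a, b) ∈ κ := fun a b => by
      rw [← mem_cells, ← hins]
      simp
    have hμ : j < μ.rowLen i := mem_iff_lt_rowLen.1 ((hmem i j).2 (.inl ⟨rfl, rfl⟩))
    have not_right : (i, j + 1) ∉ μ := fun h => by
      rcases (hmem i (j + 1)).1 h with h | h
      · omega
      · exact hij (κ.up_left_mem le_rfl (by omega) h)
    have not_below : (i + 1, j) ∉ μ := fun h => by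
      rcases (hmem (i + 1) j).1 h with h | h
      · omega
      · exact hij (κ.up_left_mem (by omega) le_rfl h)
    rw [mem_iff_lt_rowLen] at not_right not_below
    have hi : μ.rowLen (i + 1) < μ.rowLen i := by omega
    have hj : μ.rowLen i - 1 = j := by omega
    refine ⟨i, Finset.mem_filter.2 ⟨Finset.mem_range.2 (fst_lt_card (last_mem i hi)), hi⟩,
      YoungDiagram.ext ?_⟩
    change μ.cells.erase (i, μ.rowLen i - 1) = κ.cells
    rw [← hins, hj]
    exact Finset.erase_insert hij

theorem card_upper (μ : YoungDiagram) : μ.upper.card = μ.lower.card + 1 := by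
  rw [card_upper_eq_card_filter, card_lower_eq_card_filter, Finset.card_filter,
    Finset.card_filter, Finset.sum_range_succ']
  simp

/-- The commutation relation `DU = UD + 1` of the down and up operators on Young's lattice. -/
theorem sum_upper_sum_lower (f : YoungDiagram → ℕ) (μ : YoungDiagram) :
    ∑ ν ∈ μ.upper, ∑ κ ∈ ν.lower, f κ = f μ + ∑ ρ ∈ μ.lower, ∑ κ ∈ ρ.upper, f κ := by
  classical
  have h1 : ∀ ν ∈ μ.upper, ∑ κ ∈ ν.lower, f κ = f μ + ∑ κ ∈ ν.lower.erase μ, f κ := fun ν hν =>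
    (Finset.add_sum_erase _ _ (mem_lower.2 (mem_upper.1 hν))).symm
  have h2 : ∀ ρ ∈ μ.lower, ∑ κ ∈ ρ.upper, f κ = f μ + ∑ κ ∈ ρ.upper.erase μ, f κ := fun ρ hρ =>
    (Finset.add_sum_erase _ _ (mem_upper.2 (mem_lower.1 hρ))).symm
  have h3 : ∑ ν ∈ μ.upper, ∑ κ ∈ ν.lower.erase μ, f κ =
      ∑ ρ ∈ μ.lower, ∑ κ ∈ ρ.upper.erase μ, f κ := by
    have sup_eq : ∀ ν κ, ν ∈ μ.upper → κ ∈ ν.lower.erase μ → μ ⊔ κ = ν := by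
      intro ν κ hν hκ
      obtain ⟨hne, hκ⟩ := Finset.mem_erase.1 hκ
      rw [mem_upper] at hν
      rw [mem_lower] at hκ
      refine eq_of_le_of_card_le (sup_le hν.1 hκ.1) ?_
      by_contra hlt
      have h := eq_of_le_of_card_le (le_sup_left : μ ≤ μ ⊔ κ) (by omega)
      exact hne (eq_of_le_of_card_le (sup_eq_left.1 h.symm) (by omega))
    have inf_eq : ∀ ρ κ, ρ ∈ μ.lower → κ ∈ ρ.upper.erase μ → μ ⊓ κ = ρ := by
      intro ρ κ hρ hκ
      obtain ⟨hne, hκ⟩ := Finset.mem_erase.1 hκ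
      rw [mem_lower] at hρ
      rw [mem_upper] at hκ
      refine (eq_of_le_of_card_le (le_inf hρ.1 hκ.1) ?_).symm
      by_contra hlt
      have h := eq_of_le_of_card_le (inf_le_left : μ ⊓ κ ≤ μ) (by omega)
      exact hne (eq_of_le_of_card_le (inf_eq_left.1 h) (by omega)).symm
    rw [Finset.sum_sigma', Finset.sum_sigma']
    refine Finset.sum_bij' (fun p _ => ⟨μ ⊓ p.2, p.2⟩) (fun p _ => ⟨μ ⊔ p.2, p.2⟩) ?_ ?_ ?_ ?_ ?_
    · rintro ⟨ν, κ⟩ hp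
      obtain ⟨hν, hκ⟩ := Finset.mem_sigma.1 hp
      have hs := sup_eq ν κ hν hκ
      have hc := card_sup_add_card_inf μ κ
      obtain ⟨hne, hκ⟩ := Finset.mem_erase.1 hκ
      rw [mem_upper] at hν
      rw [mem_lower] at hκ
      rw [hs] at hc
      dsimp only at *
      rw [Finset.mem_sigma, Finset.mem_erase, mem_lower, mem_upper]
      exact ⟨⟨inf_le_left, by dsimp only; omega⟩, hne, inf_le_right, by dsimp only; omega⟩
    · rintro ⟨ρ, κ⟩ hp
      obtain ⟨hρ, hκ⟩ := Finset.mem_sigma.1 hp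
      have hs := inf_eq ρ κ hρ hκ
      have hc := card_sup_add_card_inf μ κ
      obtain ⟨hne, hκ⟩ := Finset.mem_erase.1 hκ
      rw [mem_lower] at hρ
      rw [mem_upper] at hκ
      rw [hs] at hc
      dsimp only at *
      rw [Finset.mem_sigma, Finset.mem_erase, mem_lower, mem_upper]
      exact ⟨⟨le_sup_left, by dsimp only; omega⟩, hne, le_sup_right, by dsimp only; omega⟩
    · rintro ⟨ν, κ⟩ hp
      obtain ⟨hν, hκ⟩ := Finset.mem_sigma.1 hp
      simp [sup_eq ν κ hν hκ]
    · rintro ⟨ρ, κ⟩ hp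
      obtain ⟨hρ, hκ⟩ := Finset.mem_sigma.1 hp
      simp [inf_eq ρ κ hρ hκ]
    · intro p _
      rfl
  rw [Finset.sum_congr rfl h1, Finset.sum_congr rfl h2, Finset.sum_add_distrib,
    Finset.sum_add_distrib, h3, Finset.sum_const, Finset.sum_const, card_upper]
  simp only [smul_eq_mul]
  ring

end YoungDiagram

/-- Walks of length `n` from `u` to `v` with steps labelled by `E`, where `T w` is the set of pairs
`⟨e, w'⟩` such that `w' → w` is a step with label `e`. -/
def LabelledWalk {V E : Type*} (T : V → Finset (Σ _ : E, V)) (u : V) (n : ℕ) (v : V) : Type _ :=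
  {p : (Fin (n + 1) → V) × (Fin n → E) // p.1 0 = u ∧ p.1 (Fin.last n) = v ∧
    ∀ i : Fin n, ⟨p.2 i, p.1 i.castSucc⟩ ∈ T (p.1 i.succ)}

namespace LabelledWalk

variable {V E : Type*} {T : V → Finset (Σ _ : E, V)} {u : V}

theorem sigma_ext {n : ℕ} {v : V} {a b : Σ q : T v, LabelledWalk T u n q.1.2}
    (h : a.1.1 = b.1.1) (h' : a.2.1 = b.2.1) : a = b := by
  obtain ⟨⟨p, hp⟩, x⟩ := a
  obtain ⟨⟨q, hq⟩, y⟩ := b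
  obtain rfl : p = q := h
  obtain rfl : x = y := Subtype.ext h'
  rfl

/-- Splitting off the last step of a walk. -/
def succEquiv (n : ℕ) (v : V) :
    LabelledWalk T u (n + 1) v ≃ Σ q : T v, LabelledWalk T u n q.1.2 where
  toFun p := ⟨⟨⟨p.1.2 (Fin.last n), p.1.1 (Fin.last n).castSucc⟩, by
      have h := p.2.2.2 (Fin.last n)
      rwa [Fin.succ_last, p.2.2.1] at h⟩,
    ⟨(fun i => p.1.1 i.castSucc, fun i => p.1.2 i.castSucc), p.2.1, rfl,
      fun i => p.2.2.2 i.castSucc⟩⟩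
  invFun q := ⟨(Fin.snoc (α := fun _ => V) q.2.1.1 v,
      Fin.snoc (α := fun _ => E) q.2.1.2 q.1.1.1), by
    obtain ⟨⟨⟨e, w⟩, hq⟩, ⟨⟨x, y⟩, h0, hlast, hstep⟩⟩ := q
    change x (Fin.last n) = w at hlast
    dsimp only at *
    refine ⟨(Fin.snoc_castSucc (α := fun _ => V) v x 0).trans h0, Fin.snoc_last .., fun i => ?_⟩
    induction i using Fin.lastCases with
    | last => rwa [Fin.snoc_last, Fin.succ_last, Fin.snoc_last, Fin.snoc_castSucc, hlast]
    | cast i =>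
      rw [Fin.snoc_castSucc, Fin.snoc_castSucc, Fin.succ_castSucc, Fin.snoc_castSucc]
      exact hstep i⟩
  left_inv p := by
    obtain ⟨⟨x, y⟩, h0, rfl, hstep⟩ := p
    exact Subtype.ext (Prod.ext (Fin.snoc_init_self x) (Fin.snoc_init_self y))
  right_inv q := by
    obtain ⟨⟨⟨e, w⟩, hq⟩, ⟨⟨x, y⟩, h0, hlast, hstep⟩⟩ := q
    change x (Fin.last n) = w at hlast
    refine sigma_ext ?_ ?_
    · simp [hlast]
    · simp

instance (v : V) : Subsingleton (LabelledWalk T u 0 v) :=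
  ⟨fun p q => Subtype.ext (Prod.ext
    (funext fun i => by rw [Fin.fin_one_eq_zero i, p.2.1, q.2.1]) (funext fun i => i.elim0))⟩

theorem card_zero_self : Nat.card (LabelledWalk T u 0 u) = 1 :=
  Nat.card_eq_one_iff_unique.2
    ⟨inferInstance, ⟨⟨(fun _ => u, fun i => i.elim0), rfl, rfl, fun i => i.elim0⟩⟩⟩

theorem card_zero_of_ne {v : V} (h : v ≠ u) : Nat.card (LabelledWalk T u 0 v) = 0 :=
  Nat.card_eq_zero.2 (.inl ⟨fun p => h (p.2.2.1.symm.trans p.2.1)⟩)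

instance (n : ℕ) (v : V) : Finite (LabelledWalk T u n v) := by
  induction n generalizing v with
  | zero => infer_instance
  | succ n ih => exact Finite.of_equiv _ (succEquiv n v).symm

theorem card_succ (n : ℕ) (v : V) :
    Nat.card (LabelledWalk T u (n + 1) v) = ∑ q ∈ T v, Nat.card (LabelledWalk T u n q.2) := by
  rw [Nat.card_congr (succEquiv n v), Nat.card_sigma, Finset.sum_coe_sort (T v)
    fun q => Nat.card (LabelledWalk T u n q.2)]

end LabelledWalk

open YoungDiagram

theorem sytCount_eq_card_labelledWalk (μ : YoungDiagram) :
    sytCount μ = Nat.card (LabelledWalk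
      (fun ν : YoungDiagram => (Finset.univ : Finset Unit).sigma fun _ => ν.lower) ⊥ μ.card μ) :=
  Nat.card_congr
    { toFun := fun c => ⟨(c.1, fun _ => ()), c.2.1, c.2.2.1, fun i =>
        Finset.mem_sigma.2 ⟨Finset.mem_univ _, mem_lower.2 (c.2.2.2 i)⟩⟩
      invFun := fun p => ⟨p.1.1, p.2.1, p.2.2.1, fun i =>
        mem_lower.1 (Finset.mem_sigma.1 (p.2.2.2 i)).2⟩
      left_inv := fun _ => rfl
      right_inv := fun _ => rfl }

theorem sytCount_bot : sytCount ⊥ = 1 := by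
  rw [sytCount_eq_card_labelledWalk]
  exact LabelledWalk.card_zero_self

theorem sytCount_eq_sum_lower {μ : YoungDiagram} (h : μ ≠ ⊥) :
    sytCount μ = ∑ κ ∈ μ.lower, sytCount κ := by
  obtain ⟨n, hn⟩ := Nat.exists_eq_succ_of_ne_zero (mt card_eq_zero.1 h)
  rw [sytCount_eq_card_labelledWalk, hn, LabelledWalk.card_succ, Finset.sum_sigma,
    Fintype.sum_unique]
  refine Finset.sum_congr rfl fun κ hκ => ?_
  have hc : κ.card = n := by
    have := (mem_lower.1 hκ).2
    omega
  rw [sytCount_eq_card_labelledWalk, hc]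

theorem lower_bot : (⊥ : YoungDiagram).lower = ∅ := by
  refine Finset.eq_empty_of_forall_notMem fun κ hκ => ?_
  have := (mem_lower.1 hκ).2
  rw [card_eq_zero.2 rfl] at this
  omega

theorem sum_upper_sytCount (μ : YoungDiagram) :
    ∑ ν ∈ μ.upper, sytCount ν = (μ.card + 1) * sytCount μ := by
  induction hn : μ.card generalizing μ with
  | zero =>
    obtain rfl := card_eq_zero.1 hn
    have h := sum_upper_sum_lower sytCount ⊥
    rw [lower_bot, Finset.sum_empty] at h
    rw [zero_add, one_mul, ← add_zero (sytCount ⊥), ← h]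
    refine Finset.sum_congr rfl fun ν hν => sytCount_eq_sum_lower ?_
    rintro rfl
    have := (mem_upper.1 hν).2
    omega
  | succ n ih =>
    have hμ : μ ≠ ⊥ := fun h => by
      have := card_eq_zero.2 h
      omega
    have hlow : ∀ ρ ∈ μ.lower, ∑ κ ∈ ρ.upper, sytCount κ = (n + 1) * sytCount ρ := fun ρ hρ =>
      ih ρ (by have := (mem_lower.1 hρ).2; omega)
    have hup : ∀ ν ∈ μ.upper, sytCount ν = ∑ κ ∈ ν.lower, sytCount κ := fun ν hν =>
      sytCount_eq_sum_lower fun h => by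
        have := card_eq_zero.2 h
        have := (mem_upper.1 hν).2
        omega
    rw [Finset.sum_congr rfl hup, sum_upper_sum_lower, Finset.sum_congr rfl hlow,
      ← Finset.mul_sum, ← sytCount_eq_sum_lower hμ]
    ring

namespace LimitingVacillatingTableau

/-- The last steps `⟨λ⁽ʲ⁺¹ᐟ²⁾, λ⁽ʲ⁾⟩` that can lead to `λ⁽ʲ⁺¹⁾ = ν`. -/
noncomputable def steps (ν : YoungDiagram) : Finset (Σ _ : YoungDiagram, YoungDiagram) :=
  ν.lower.sigma fun κ => κ.upper.cons κ (notMem_upper κ)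

theorem mem_steps {ν : YoungDiagram} {q : Σ _ : YoungDiagram, YoungDiagram} :
    q ∈ steps ν ↔ (q.1 ≤ ν ∧ ν.card = q.1.card + 1) ∧
      (q.1 = q.2 ∨ (q.1 ≤ q.2 ∧ q.2.card = q.1.card + 1)) := by
  rw [steps, Finset.mem_sigma, Finset.mem_cons, mem_lower, mem_upper, eq_comm (a := q.2)]

theorem card_labelledWalk (k : ℕ) (ν : YoungDiagram) :
    Nat.card (LabelledWalk steps ⊥ k ν) = Nat.stirlingSecond k ν.card * sytCount ν := by
  induction k generalizing ν with
  | zero =>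
    by_cases h : ν = ⊥
    · subst h
      rw [LabelledWalk.card_zero_self, sytCount_bot, card_eq_zero.2 rfl]
      rfl
    · obtain ⟨n, hn⟩ := Nat.exists_eq_succ_of_ne_zero (mt card_eq_zero.1 h)
      rw [LabelledWalk.card_zero_of_ne h, hn, Nat.stirlingSecond_zero_succ, zero_mul]
  | succ k ih =>
    simp only [LabelledWalk.card_succ, ih]
    rw [steps, Finset.sum_sigma]
    by_cases h : ν = ⊥
    · subst h
      rw [lower_bot, card_eq_zero.2 rfl, Nat.stirlingSecond_succ_zero, Finset.sum_empty, zero_mul]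
    · obtain ⟨n, hn⟩ := Nat.exists_eq_succ_of_ne_zero (mt card_eq_zero.1 h)
      rw [hn, Nat.succ_eq_add_one, Nat.stirlingSecond_succ_succ, sytCount_eq_sum_lower h,
        Finset.mul_sum]
      refine Finset.sum_congr rfl fun κ hκ => ?_
      have hc : κ.card = n := by
        have := (mem_lower.1 hκ).2
        omega
      have hup : ∀ ρ ∈ κ.upper, Nat.stirlingSecond k ρ.card * sytCount ρ =
          Nat.stirlingSecond k (n + 1) * sytCount ρ := fun ρ hρ => by
        rw [(mem_upper.1 hρ).2, hc]
      rw [Finset.sum_cons, Finset.sum_congr rfl hup, ← Finset.mul_sum, sum_upper_sytCount,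
        hc]
      ring

/-- Tableaux as walks, grouped according to their final diagram. -/
def equivSigmaLabelledWalk (k : ℕ) :
    LimitingVacillatingTableau k ≃ Σ ν : YoungDiagram, LabelledWalk steps ⊥ k ν where
  toFun t := ⟨t.lam (Fin.last k), (t.lam, t.mu), t.init, rfl, fun j =>
    mem_steps.2 ⟨t.full_step j, t.half_step j⟩⟩
  invFun p := ⟨p.2.1.1, p.2.1.2, p.2.2.1, fun j => (mem_steps.1 (p.2.2.2.2 j)).2,
    fun j => (mem_steps.1 (p.2.2.2.2 j)).1⟩
  left_inv _ := rfl
  right_inv := by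
    rintro ⟨_, ⟨x, y⟩, h0, rfl, h⟩
    rfl

theorem card_eq_sum (k : ℕ) :
    Nat.card (LimitingVacillatingTableau k) =
      ∑ ν ∈ (finite_card_le k).toFinset, Nat.stirlingSecond k ν.card * sytCount ν := by
  have mem_of_nonempty : ∀ ν : YoungDiagram, Nonempty (LabelledWalk steps ⊥ k ν) →
      ν ∈ (finite_card_le k).toFinset := fun ν hν => by
    rw [Set.Finite.mem_toFinset]
    by_contra hlt
    have h := card_labelledWalk k ν
    rw [Nat.stirlingSecond_eq_zero_of_lt (not_le.1 hlt), zero_mul] at h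
    exact Nat.card_pos.ne' h
  let e : (Σ ν : YoungDiagram, LabelledWalk steps ⊥ k ν) ≃
      Σ ν : (finite_card_le k).toFinset, LabelledWalk steps ⊥ k ν.1 :=
    { toFun := fun p => ⟨⟨p.1, mem_of_nonempty p.1 ⟨p.2⟩⟩, p.2⟩
      invFun := fun p => ⟨p.1.1, p.2⟩
      left_inv := fun _ => rfl
      right_inv := fun _ => rfl }
  rw [Nat.card_congr ((equivSigmaLabelledWalk k).trans e), Nat.card_sigma]
  simp only [card_labelledWalk]
  exact Finset.sum_coe_sort _ fun ν => Nat.stirlingSecond k ν.card * sytCount ν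

end LimitingVacillatingTableau

theorem card_limitingVacillatingTableau_eq_sum_stirling_mul_syt (k : ℕ) (hk : 0 < k) :
    Nat.card (LimitingVacillatingTableau k)
      = ∑ j ∈ Finset.Icc 1 k,
          stirling k j * ∑ᶠ (μ : YoungDiagram) (_ : μ.card = j), sytCount μ := by
  have hfin : ∀ j ∈ Finset.Icc 1 k, ∑ᶠ (μ : YoungDiagram) (_ : μ.card = j), sytCount μ =
      ∑ μ ∈ (finite_card_le k).toFinset with μ.card = j, sytCount μ := fun j hj => by
    refine finsum_mem_eq_sum_of_inter_support_eq (s := {μ : YoungDiagram | μ.card = j}) _ ?_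
    congr 1
    ext μ
    have := (Finset.mem_Icc.1 hj).2
    simp only [Set.mem_ofPred_eq, Finset.coe_filter, Set.Finite.mem_toFinset]
    omega
  obtain ⟨m, rfl⟩ := Nat.exists_eq_succ_of_ne_zero hk.ne'
  rw [LimitingVacillatingTableau.card_eq_sum,
    ← Finset.sum_fiberwise_of_maps_to (t := Finset.range (m + 1 + 1)) (g := YoungDiagram.card)
      (fun ν hν => Finset.mem_range_succ_iff.2 ((finite_card_le _).mem_toFinset.1 hν)),
    ← Finset.sum_subset (s₁ := Finset.Icc 1 (m + 1)) (fun j hj => ?_) fun j hj hj' => ?_]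
  · refine Finset.sum_congr rfl fun j hj => ?_
    rw [hfin j hj, stirling_eq_stirlingSecond, Finset.mul_sum]
    exact Finset.sum_congr rfl fun ν hν => by rw [(Finset.mem_filter.1 hν).2]
  · simp only [Finset.mem_Icc, Finset.mem_range] at *
    omega
  · obtain rfl : j = 0 := by
      simp only [Finset.mem_Icc, Finset.mem_range] at *
      omega
    refine Finset.sum_eq_zero fun ν hν => ?_
    rw [(Finset.mem_filter.1 hν).2, Nat.stirlingSecond_succ_zero, zero_mul]
end
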